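/- Let M and S be subgroups of a finite group G and p a prime. Suppose R_m and R_s are elementary abelian groups acting coprimely on M and on S respectively, that C_M(O_p(M)) ≤ O_p(M) and C_S(O_p(S)) ≤ O_p(S), that O_p(M;R_m) = O_p(S;R_s) as subgroups of G, and that C_S(Y_M) ≤ M. Set P = O_p(M)·O_p(S), W = ⟨α(Y_M) : α ∈ Aut(S)⟩, and let Q be the preimage in S of O_p(S/C_S(W)). Then P ∩ Q ≤ O_p(S). -/

import Mathlib

open Subgroup

section Defs

variable {R G : Type*} [Group R] [Group G]

/-- A subgroup is invariant under the action `φ`. -/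
def RInv (φ : R →* MulAut G) (H : Subgroup G) : Prop :=
  ∀ x : R, H.map (φ x).toMonoidHom = H

/-- `O_p(G;R)`: the intersection of all `R`-invariant Sylow `p`-subgroups of `G`. -/
noncomputable def OpR (φ : R →* MulAut G) (p : ℕ) : Subgroup G :=
  ⨅ Q : {Q : Sylow p G // RInv φ (Q : Subgroup G)}, ((Q : Sylow p G) : Subgroup G)

/-- `O_p(G)`: for a finite group, the intersection of all Sylow `p`-subgroups. -/
noncomputable def pCore (p : ℕ) (G : Type*) [Group G] : Subgroup G :=
  ⨅ Q : Sylow p G, (Q : Subgroup G)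

/-- `Y_M = ⟨Ω₁(Z(T)) : T ∈ Syl_p(M)⟩`. -/
noncomputable def Ysub (p : ℕ) (M : Type*) [Group M] : Subgroup M :=
  Subgroup.closure {z : M | z ^ p = 1 ∧ ∃ T : Sylow p M,
    z ∈ (T : Subgroup M) ∧ z ∈ Subgroup.centralizer ((T : Subgroup M) : Set M)}

/-- The Thompson subgroup `J(P)` of a subgroup `P`:  the subgroup generated by the abelian
subgroups of `P` of maximal order. -/
noncomputable def Jsub (P : Subgroup G) : Subgroup G :=
  ⨆ A ∈ {A : Subgroup G | A ≤ P ∧ (∀ a ∈ A, ∀ b ∈ A, a * b = b * a) ∧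
      ∀ B : Subgroup G, B ≤ P → (∀ a ∈ B, ∀ b ∈ B, a * b = b * a) →
        Nat.card ↥B ≤ Nat.card ↥A}, A

end Defs

theorem pCore_le_sylow {H : Type*} [Group H] {p : ℕ} (T : Sylow p H) :
    pCore p H ≤ (T : Subgroup H) :=
  iInf_le _ T

theorem pCore_le_OpR {R H : Type*} [Group R] [Group H] (φ : R →* MulAut H) (p : ℕ) :
    pCore p H ≤ OpR φ p :=
  le_iInf fun T => pCore_le_sylow T.1

theorem pCore_isPGroup (p : ℕ) (H : Type*) [Group H] : IsPGroup p (pCore p H) :=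
  let T : Sylow p H := default
  T.isPGroup'.to_le (pCore_le_sylow T)

instance pCore_normal (p : ℕ) (H : Type*) [Group H] : (pCore p H).Normal where
  conj_mem x hx g := by
    refine Subgroup.mem_iInf.2 fun T => ?_
    have h : x ∈ ((g⁻¹ • T : Sylow p H) : Subgroup H) := pCore_le_sylow _ hx
    rw [Sylow.coe_subgroup_smul, Subgroup.mem_pointwise_smul_iff_inv_smul_mem] at h
    simpa using h

theorem Ysub_le_pCore {H : Type*} [Group H] {p : ℕ}
    (h : Subgroup.centralizer (pCore p H : Set H) ≤ pCore p H) : Ysub p H ≤ pCore p H := by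
  refine (Subgroup.closure_le _).2 ?_
  rintro z ⟨-, T, -, hz⟩
  exact h (Subgroup.centralizer_le (pCore_le_sylow T) hz)

/-- The subgroup generated by the images of `Y` under all automorphisms is normal. -/
theorem iSup_map_mulAut_normal {H : Type*} [Group H] (Y : Subgroup H) :
    (⨆ α : MulAut H, Y.map α.toMonoidHom).Normal where
  conj_mem x hx g := by
    have h : (⨆ α : MulAut H, Y.map α.toMonoidHom) ≤
        (⨆ α : MulAut H, Y.map α.toMonoidHom).comap (MulAut.conj g).toMonoidHom := by
      refine iSup_le fun α => ?_
      rintro _ ⟨y, hy, rfl⟩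
      exact Subgroup.mem_iSup_of_mem (MulAut.conj g * α) ⟨y, hy, rfl⟩
    exact h hx

theorem conj_mem_map_subtype {G : Type*} [Group G] {H : Subgroup G} {N : Subgroup H} [N.Normal]
    {g x : G} (hg : g ∈ H) (hx : x ∈ N.map H.subtype) : g * x * g⁻¹ ∈ N.map H.subtype := by
  obtain ⟨n, hn, rfl⟩ := hx
  exact ⟨⟨g, hg⟩ * n * ⟨g, hg⟩⁻¹, Subgroup.Normal.conj_mem ‹_› n hn _, rfl⟩

theorem le_normalizer_map_subtype {G : Type*} [Group G] {H : Subgroup G} (N : Subgroup H)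
    [N.Normal] : H ≤ Subgroup.normalizer (N.map H.subtype) := by
  intro g hg
  refine Subgroup.mem_normalizer_iff.2 fun x => ⟨conj_mem_map_subtype hg, fun hx => ?_⟩
  simpa [mul_assoc] using conj_mem_map_subtype (H.inv_mem hg) hx

/-- A normal subgroup which is a `p`-group modulo `C` lies in `TC` for every Sylow
`p`-subgroup `T`. -/
theorem le_sylow_sup_of_pow_mem {H : Type*} [Group H] [Finite H] {p : ℕ} [Fact p.Prime]
    (T : Sylow p H) {C X : Subgroup H} [C.Normal] (hX : X.Normal)
    (h : ∀ x ∈ X, ∃ n : ℕ, x ^ p ^ n ∈ C) : X ≤ (T : Subgroup H) ⊔ C := by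
  have hs := QuotientGroup.mk'_surjective C
  have hN : (X.map (QuotientGroup.mk' C)).Normal := hX.map _ hs
  have hp : IsPGroup p (X.map (QuotientGroup.mk' C)) := by
    rintro ⟨_, x, hx, rfl⟩
    obtain ⟨n, hn⟩ := h x hx
    refine ⟨n, Subtype.ext ?_⟩
    simpa [← QuotientGroup.mk_pow] using hn
  have hle := hp.le_sylow_of_normal (T.mapSurjective hs)
  rw [Sylow.coe_mapSurjective, Subgroup.map_le_map_iff, QuotientGroup.ker_mk'] at hle
  exact hle

/-- A `p`-subgroup of `TC` normalized by `C` lies in the Sylow `p`-subgroup `T`. -/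
theorem le_sylow_of_le_sup_of_conj_mem {H : Type*} [Group H] [Finite H] {p : ℕ} [Fact p.Prime]
    (T : Sylow p H) {A C : Subgroup H} [C.Normal] (hA : IsPGroup p A)
    (hAC : ∀ c ∈ C, ∀ a ∈ A, c * a * c⁻¹ ∈ A) (hle : A ≤ (T : Subgroup H) ⊔ C) :
    A ≤ (T : Subgroup H) := by
  set K : Subgroup H := (T : Subgroup H) ⊔ C
  have hA' : IsPGroup p (A.subgroupOf K) := hA.comap_subtype
  obtain ⟨U, hU⟩ := hA'.exists_le_sylow
  obtain ⟨⟨k, hk⟩, hkU⟩ := MulAction.exists_smul_eq K U (T.subtype le_sup_left)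
  obtain ⟨t, ht, c, hc, rfl⟩ := Subgroup.mem_sup_of_normal_right.1 hk
  intro a ha
  have hb := hAC _ (C.inv_mem hc) a ha
  have hbU := hU (show (⟨_, hle hb⟩ : K) ∈ A.subgroupOf K from hb)
  have hT : (⟨t * c, hk⟩ * ⟨_, hle hb⟩ * ⟨t * c, hk⟩⁻¹ : K) ∈
      ((T.subtype le_sup_left : Sylow p K) : Subgroup K) := by
    rw [← hkU]
    exact Subgroup.smul_mem_pointwise_smul _ (MulAut.conj (⟨t * c, hk⟩ : K)) _ hbU
  have hT' : t * c * (c⁻¹ * a * c⁻¹⁻¹) * (t * c)⁻¹ ∈ (T : Subgroup H) := hT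
  have ht' := mul_mem (mul_mem (inv_mem ht) hT') ht
  convert ht' using 1
  group

/-- Primitive-pair setup:  `M, S ≤ G` of characteristic `p`, with coprime actions of
elementary abelian groups `R_m, R_s` such that `O_p(M;R_m) = O_p(S;R_s)` and
`C_S(Y_M) ≤ M`.  Set `P = O_p(M)⬝O_p(S)`, `W = ⟨α(Y_M) : α ∈ Aut(S)⟩` and let `Q` be the
preimage in `S` of `O_p(S/C_S(W))`.  Then `P ∩ Q ≤ O_p(S)`. -/
theorem primitive_pairs_stmt17
    {G Rm Rs : Type*} [Group G] [Finite G]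
    [Group Rm] [Finite Rm] [Group Rs] [Finite Rs]
    (p : ℕ) (hp : p.Prime)
    (hRm : ∃ r : ℕ, r.Prime ∧ (∀ x y : Rm, x * y = y * x) ∧ ∀ x : Rm, x ^ r = 1)
    (hRs : ∃ r : ℕ, r.Prime ∧ (∀ x y : Rs, x * y = y * x) ∧ ∀ x : Rs, x ^ r = 1)
    (M S : Subgroup G)
    (φm : Rm →* MulAut ↥M) (φs : Rs →* MulAut ↥S)
    (hcm : Nat.Coprime (Nat.card Rm) (Nat.card ↥M))
    (hcs : Nat.Coprime (Nat.card Rs) (Nat.card ↥S))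
    (hM : Subgroup.centralizer ((pCore p ↥M : Subgroup ↥M) : Set ↥M) ≤ pCore p ↥M)
    (hS : Subgroup.centralizer ((pCore p ↥S : Subgroup ↥S) : Set ↥S) ≤ pCore p ↥S)
    (hOp : (OpR φm p).map M.subtype = (OpR φs p).map S.subtype)
    (hCS : S ⊓ Subgroup.centralizer (((Ysub p ↥M).map M.subtype : Subgroup G) : Set G) ≤ M)
    (W : Subgroup ↥S)
    (hW : W = ⨆ α : MulAut ↥S,
      ((((Ysub p ↥M).map M.subtype).comap S.subtype).map α.toMonoidHom : Subgroup ↥S))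
    (Q : Subgroup ↥S)
    (hQ : Q = sSup {X : Subgroup ↥S | X.Normal ∧
      ∀ x ∈ X, ∃ n : ℕ, x ^ p ^ n ∈ Subgroup.centralizer (W : Set ↥S)}) :
    ((pCore p ↥M).map M.subtype ⊔ (pCore p ↥S).map S.subtype) ⊓ Q.map S.subtype ≤
      (pCore p ↥S).map S.subtype := by
  have := Fact.mk hp
  have hMS : (pCore p M).map M.subtype ≤ S :=
    ((Subgroup.map_mono (pCore_le_OpR φm p)).trans hOp.le).trans (Subgroup.map_subtype_le _)
  have hSM : (pCore p S).map S.subtype ≤ M :=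
    ((Subgroup.map_mono (pCore_le_OpR φs p)).trans hOp.ge).trans (Subgroup.map_subtype_le _)
  have hYS : (Ysub p M).map M.subtype ≤ S := (Subgroup.map_mono (Ysub_le_pCore hM)).trans hMS
  have hYW : ((Ysub p M).map M.subtype).comap S.subtype ≤ W := by
    rw [hW]
    exact fun y hy => Subgroup.mem_iSup_of_mem 1 ⟨y, hy, rfl⟩
  have hWN : W.Normal := hW ▸ iSup_map_mulAut_normal _
  have hCM : ∀ c ∈ Subgroup.centralizer (W : Set S), (c : G) ∈ M := by
    intro c hc
    refine hCS ⟨c.2, fun y hy => ?_⟩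
    exact congrArg Subtype.val (hc ⟨y, hYS hy⟩ (hYW hy))
  set P := (pCore p M).map M.subtype ⊔ (pCore p S).map S.subtype
  have hPp : IsPGroup p P :=
    ((pCore_isPGroup p M).map _).to_sup_of_normal_left' ((pCore_isPGroup p S).map _)
      (hSM.trans (le_normalizer_map_subtype _))
  have hQN : Q.Normal := hQ ▸ Subgroup.sSup_normal _ fun X hX => hX.1
  have hPconj : ∀ g ∈ M, g ∈ S → ∀ x ∈ P, g * x * g⁻¹ ∈ P := by
    intro g hgM hgS x hx
    have : P ≤ P.comap (MulAut.conj g).toMonoidHom := by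
      refine sup_le ?_ ?_
      · exact fun y hy => (le_sup_left : _ ≤ P) (conj_mem_map_subtype hgM hy)
      · exact fun y hy => (le_sup_right : _ ≤ P) (conj_mem_map_subtype hgS hy)
    exact this hx
  rintro _ ⟨hxP, x, hxQ, rfl⟩
  refine ⟨x, Subgroup.mem_iInf.2 fun T => ?_, rfl⟩
  have hQT : Q ≤ (T : Subgroup S) ⊔ Subgroup.centralizer (W : Set S) := by
    rw [hQ]
    exact sSup_le fun X hX => le_sylow_sup_of_pow_mem T hX.1 hX.2
  refine le_sylow_of_le_sup_of_conj_mem (A := P.comap S.subtype ⊓ Q) T ?_ ?_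
    (inf_le_right.trans hQT) ⟨hxP, hxQ⟩
  · exact hPp.comap_subtype.to_inf_left
  · exact fun c hc a ha => ⟨hPconj c (hCM c hc) c.2 a ha.1, hQN.conj_mem a ha.2 c⟩
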